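/- Let W be a d-dimensional Brownian sheet on [0,1]^2. There exists a function C̃₁ : ℝ₊ × ℝ₊ → ℝ₊, nondecreasing in each argument, such that for every function f : [0,1]^2 × ℝ^d → ℝ that is jointly continuous, bounded, continuously differentiable in the space variable, and componentwise nondecreasing in the space variable, for every k ≥ 0, every i ∈ {1,...,d}, and every 0 < r < s ≤ 1, 0 < u < t ≤ 1, one has E[ exp( (k / (√(s−r) √(t−u))) ∫_r^s ∫_u^t ∂_{x_i} f(s₁,t₁, W_{s₁,t₁}) dt₁ ds₁ ) ] ≤ C̃₁(k, ‖f‖_∞). -/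

import Mathlib

open MeasureTheory ProbabilityTheory Set Filter

noncomputable section

/-- A `d`-dimensional Brownian sheet on `[0,1]²`. -/
def IsBrownianSheet {Ω : Type*} [MeasurableSpace Ω] (P : Measure Ω) (d : ℕ)
    (W : ℝ × ℝ → Ω → EuclideanSpace ℝ (Fin d)) : Prop :=
  (∀ p, Measurable (W p)) ∧
  (∀ ω, ContinuousOn (fun p => W p ω) (Set.Icc (0 : ℝ × ℝ) 1)) ∧
  (∀ ω, ∀ p ∈ Set.Icc (0 : ℝ × ℝ) 1, p.1 = 0 ∨ p.2 = 0 → W p ω = 0) ∧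
  (∀ (n : ℕ) (p : Fin n → ℝ × ℝ) (idx : Fin n → Fin d) (c : Fin n → ℝ),
    (∀ j, p j ∈ Set.Icc (0 : ℝ × ℝ) 1) →
    P.map (fun ω => ∑ j, c j * W (p j) ω (idx j)) =
      gaussianReal 0 (∑ j, ∑ k, c j * c k *
        (if idx j = idx k then min (p j).1 (p k).1 * min (p j).2 (p k).2 else 0)).toNNReal)

/-- The σ-algebra generated by the sheet up to `p`. -/
def sheetSigma {Ω : Type*} [MeasurableSpace Ω] {d : ℕ}
    (W : ℝ × ℝ → Ω → EuclideanSpace ℝ (Fin d)) (p : ℝ × ℝ) : MeasurableSpace Ω :=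
  ⨆ q ∈ Set.Icc (0 : ℝ × ℝ) p, MeasurableSpace.comap (W q) inferInstance

/-- A strong solution of the sheet SDE. -/
def IsStrongSolution {Ω : Type*} [MeasurableSpace Ω] (P : Measure Ω) {d : ℕ}
    (W : ℝ × ℝ → Ω → EuclideanSpace ℝ (Fin d))
    (b : ℝ × ℝ → EuclideanSpace ℝ (Fin d) → EuclideanSpace ℝ (Fin d))
    (ξ : EuclideanSpace ℝ (Fin d))
    (X : ℝ × ℝ → Ω → EuclideanSpace ℝ (Fin d)) : Prop :=
  (∀ ω, ContinuousOn (fun p => X p ω) (Set.Icc (0 : ℝ × ℝ) 1)) ∧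
  (∀ p ∈ Set.Icc (0 : ℝ × ℝ) 1, ∃ Y : Ω → EuclideanSpace ℝ (Fin d),
      Measurable[sheetSigma W p] Y ∧ ∀ᵐ ω ∂P, X p ω = Y ω) ∧
  (∀ᵐ ω ∂P, ∀ p ∈ Set.Icc (0 : ℝ × ℝ) 1,
      X p ω = ξ + (∫ t₁ in (0:ℝ)..p.2, ∫ s₁ in (0:ℝ)..p.1, b (s₁, t₁) (X (s₁, t₁) ω)) + W p ω)

section Gaussian

variable {Ω : Type*} [MeasurableSpace Ω] {P : Measure Ω} {d : ℕ}
  {W : ℝ × ℝ → Ω → EuclideanSpace ℝ (Fin d)}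

lemma IsBrownianSheet.measurable_coord (hW : IsBrownianSheet P d W) (p : ℝ × ℝ) (i : Fin d) :
    Measurable fun ω => W p ω i := by
  have := hW.1 p
  fun_prop

/-- The coordinates of a Brownian sheet form a Gaussian process. -/
lemma IsBrownianSheet.isGaussianProcess (hW : IsBrownianSheet P d W) :
    IsGaussianProcess (fun (a : Set.Icc (0 : ℝ × ℝ) 1 × Fin d) ω => W a.1 ω a.2) P := by
  refine ⟨fun I => ⟨isGaussian_of_map_eq_gaussianReal fun L => ?_⟩⟩
  have hm : Measurable fun ω => I.restrict
      (fun a : Set.Icc (0 : ℝ × ℝ) 1 × Fin d => W a.1 ω a.2) := by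
    refine measurable_pi_lambda _ fun a => ?_
    exact hW.measurable_coord _ _
  have hL : ∀ x : I → ℝ, L x = ∑ j : Fin (Fintype.card I),
      L (Pi.single ((Fintype.equivFin I).symm j) 1) * x ((Fintype.equivFin I).symm j) := by
    intro x
    rw [(Fintype.equivFin I).symm.sum_comp (fun a => L (Pi.single a 1) * x a)]
    conv_lhs => rw [← Finset.univ_sum_single x]
    rw [map_sum]
    refine Finset.sum_congr rfl fun a _ => ?_
    have : (Pi.single a (x a) : I → ℝ) = x a • Pi.single a 1 := by
      rw [← Pi.single_smul]; simp
    rw [this, map_smul, smul_eq_mul, mul_comm]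
  have key := hW.2.2.2 (Fintype.card I) (fun j => ((Fintype.equivFin I).symm j).1.1)
    (fun j => ((Fintype.equivFin I).symm j).1.2)
    (fun j => L (Pi.single ((Fintype.equivFin I).symm j) 1))
    (fun j => ((Fintype.equivFin I).symm j).1.1.2)
  have hmap : (P.map fun ω => I.restrict
      (fun a : Set.Icc (0 : ℝ × ℝ) 1 × Fin d => W a.1 ω a.2)).map L = P.map _ :=
    (Measure.map_map (by fun_prop) hm).trans (congrArg (fun X => P.map X) (funext fun ω => hL _))
  exact ⟨0, _, hmap.trans key⟩

lemma IsBrownianSheet.memLp_coord (hW : IsBrownianSheet P d W) {p : ℝ × ℝ}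
    (hp : p ∈ Set.Icc (0 : ℝ × ℝ) 1) (i : Fin d) : MemLp (fun ω => W p ω i) 2 P :=
  (hW.isGaussianProcess.hasGaussianLaw_eval (⟨p, hp⟩, i)).memLp_two

lemma IsBrownianSheet.variance_add (hW : IsBrownianSheet P d W) {p q : ℝ × ℝ}
    (hp : p ∈ Set.Icc (0 : ℝ × ℝ) 1) (hq : q ∈ Set.Icc (0 : ℝ × ℝ) 1) (i j : Fin d) {a b : ℝ}
    (ha : 0 ≤ a) (hb : 0 ≤ b) :
    Var[fun ω => a * W p ω i + b * W q ω j; P] =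
      a ^ 2 * (p.1 * p.2) + b ^ 2 * (q.1 * q.2) +
      2 * a * b * (if i = j then min p.1 q.1 * min p.2 q.2 else 0) := by
  have h := hW.2.2.2 2 ![p, q] ![i, j] ![a, b] (Fin.forall_fin_two.2 ⟨hp, hq⟩)
  simp only [Fin.sum_univ_two, Matrix.cons_val_zero, Matrix.cons_val_one, min_self, if_true] at h
  have h1 := hW.measurable_coord p i
  have h2 := hW.measurable_coord q j
  have hm : AEMeasurable (fun ω => a * W p ω i + b * W q ω j) P :=
    ((h1.const_mul a).add (h2.const_mul b)).aemeasurable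
  rw [← variance_id_map hm, h, variance_id_gaussianReal, Real.coe_toNNReal]
  · by_cases hij : i = j
    · simp [hij, min_comm q.1, min_comm q.2]; ring
    · simp [hij, Ne.symm hij]; ring
  · have := hp.1.1; have := hp.1.2; have := hq.1.1; have := hq.1.2
    simp only [Prod.fst_zero, Prod.snd_zero] at *
    have : 0 ≤ min p.1 q.1 * min p.2 q.2 := by positivity
    have : 0 ≤ min q.1 p.1 * min q.2 p.2 := by positivity
    split_ifs <;> positivity

lemma IsBrownianSheet.covariance_coord [IsProbabilityMeasure P] (hW : IsBrownianSheet P d W)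
    {p q : ℝ × ℝ}
    (hp : p ∈ Set.Icc (0 : ℝ × ℝ) 1) (hq : q ∈ Set.Icc (0 : ℝ × ℝ) 1) (i j : Fin d) :
    cov[fun ω => W p ω i, fun ω => W q ω j; P] =
      if i = j then min p.1 q.1 * min p.2 q.2 else 0 := by
  have h := hW.variance_add hp hq i j zero_le_one zero_le_one
  have h1 := hW.variance_add hp hq i j zero_le_one le_rfl
  have h2 := hW.variance_add hp hq i j le_rfl zero_le_one
  simp only [one_mul, zero_mul, add_zero, zero_add] at h h1 h2
  rw [variance_fun_add (hW.memLp_coord hp i) (hW.memLp_coord hq j), h1, h2] at h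
  linarith

/-- Increments of the coordinates of a Brownian sheet form a Gaussian process. -/
lemma IsBrownianSheet.isGaussianProcess_sub (hW : IsBrownianSheet P d W) :
    IsGaussianProcess (fun (a : (Set.Icc (0 : ℝ × ℝ) 1 × Set.Icc (0 : ℝ × ℝ) 1) × Fin d) ω =>
      W a.1.1 ω a.2 - W a.1.2 ω a.2) P := by
  classical
  refine hW.isGaussianProcess.of_isGaussianProcess fun a => ⟨{(a.1.1, a.2), (a.1.2, a.2)},
    { toFun x := x ⟨(a.1.1, a.2), by simp⟩ - x ⟨(a.1.2, a.2), by simp⟩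
      map_add' x y := by simp; abel
      map_smul' c x := by simp; ring }, fun ω => by simp⟩

lemma IsBrownianSheet.covariance_sub [IsProbabilityMeasure P] (hW : IsBrownianSheet P d W)
    {p q p' q' : ℝ × ℝ} (hp : p ∈ Set.Icc (0 : ℝ × ℝ) 1) (hq : q ∈ Set.Icc (0 : ℝ × ℝ) 1)
    (hp' : p' ∈ Set.Icc (0 : ℝ × ℝ) 1) (hq' : q' ∈ Set.Icc (0 : ℝ × ℝ) 1) (i j : Fin d) :
    cov[fun ω => W p ω i - W q ω i, fun ω => W p' ω j - W q' ω j; P] =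
      if i = j then min p.1 p'.1 * min p.2 p'.2 - min p.1 q'.1 * min p.2 q'.2
        - min q.1 p'.1 * min q.2 p'.2 + min q.1 q'.1 * min q.2 q'.2 else 0 := by
  rw [covariance_fun_sub_fun_sub (hW.memLp_coord hp i) (hW.memLp_coord hq i)
    (hW.memLp_coord hp' j) (hW.memLp_coord hq' j), hW.covariance_coord hp hp',
    hW.covariance_coord hp hq', hW.covariance_coord hq hp', hW.covariance_coord hq hq']
  split_ifs <;> ring

/-- The law of a coordinate of an increment along a line. -/
lemma IsBrownianSheet.map_sub (hW : IsBrownianSheet P d W) {a b τ : ℝ}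
    (ha : 0 ≤ a) (hab : a ≤ b) (hb : b ≤ 1) (hτ : 0 ≤ τ) (hτ' : τ ≤ 1) (i : Fin d) :
    P.map (fun ω => W (b, τ) ω i - W (a, τ) ω i) = gaussianReal 0 ((b - a) * τ).toNNReal := by
  have h := hW.2.2.2 2 ![(b, τ), (a, τ)] ![i, i] ![1, -1] (by
    simp [Fin.forall_fin_two, Prod.le_def]
    refine ⟨⟨⟨?_, ?_⟩, ?_, ?_⟩, ⟨?_, ?_⟩, ?_, ?_⟩ <;> linarith)
  simp only [Fin.sum_univ_two, Matrix.cons_val_zero, Matrix.cons_val_one, min_self, if_true,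
    min_eq_right hab, min_eq_left hab] at h
  convert h using 2
  · funext ω; ring
  · congr 1; ring

/-- Increments along a line are independent. -/
lemma IsBrownianSheet.indepFun_sub [IsProbabilityMeasure P] (hW : IsBrownianSheet P d W)
    {a b τ : ℝ} (ha : 0 ≤ a) (hab : a ≤ b) (hb : b ≤ 1) (hτ : 0 ≤ τ) (hτ' : τ ≤ 1)
    {c : ℕ → ℝ} (hc : ∀ l, b ≤ c l) (hc' : ∀ l, c l ≤ 1) :
    IndepFun (fun ω => W (b, τ) ω - W (a, τ) ω)
      (fun ω (l : ℕ) => W (c l, τ) ω - W (b, τ) ω) P := by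
  have hmem : ∀ x : ℝ, 0 ≤ x → x ≤ 1 → (x, τ) ∈ Set.Icc (0 : ℝ × ℝ) 1 := fun x h h' =>
    ⟨⟨h, hτ⟩, ⟨h', hτ'⟩⟩
  have hb0 := ha.trans hab
  have hc0 : ∀ l, 0 ≤ c l := fun l => hb0.trans (hc l)
  have hmc : ∀ p i, Measurable fun ω => W p ω i := hW.measurable_coord
  have hi := IsGaussianProcess.indepFun_of_covariance_eq_zero (P := P)
    (X := fun (i : Fin d) ω => W (b, τ) ω i - W (a, τ) ω i)
    (Y := fun (z : ℕ × Fin d) ω => W (c z.1, τ) ω z.2 - W (b, τ) ω z.2) (by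
      have := hW.isGaussianProcess_sub.comp_right (S := Fin d ⊕ ℕ × Fin d) (Sum.elim
        (fun i => ((⟨(b, τ), hmem b hb0 hb⟩, ⟨(a, τ), hmem a ha (hab.trans hb)⟩), i))
        (fun z => ((⟨(c z.1, τ), hmem _ (hc0 _) (hc' _)⟩, ⟨(b, τ), hmem b hb0 hb⟩), z.2)))
      refine this.congr ?_
      rintro (_ | _) <;> exact .rfl)
    (fun i => ((hmc (b, τ) i).sub (hmc (a, τ) i)).aemeasurable)
    (fun z => ((hmc (c z.1, τ) z.2).sub (hmc (b, τ) z.2)).aemeasurable)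
    (fun i z => by
      rw [hW.covariance_sub (hmem b hb0 hb) (hmem a ha (hab.trans hb))
        (hmem _ (hc0 _) (hc' _)) (hmem b hb0 hb)]
      simp [min_eq_left (hc z.1), min_eq_left hab, min_eq_left (hab.trans (hc z.1))])
  have := hi.comp (φ := fun x : Fin d → ℝ => (WithLp.toLp 2 x : EuclideanSpace ℝ (Fin d)))
    (ψ := fun (x : ℕ × Fin d → ℝ) (l : ℕ) =>
      (WithLp.toLp 2 fun i => x (l, i) : EuclideanSpace ℝ (Fin d)))
    (by fun_prop) (by
      refine measurable_pi_lambda _ fun l => ?_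
      fun_prop)
  exact this

/-- A coordinate of an increment along a line is independent of the other coordinates. -/
lemma IsBrownianSheet.indepFun_coord [IsProbabilityMeasure P] (hW : IsBrownianSheet P d W)
    {p q : ℝ × ℝ} (hp : p ∈ Set.Icc (0 : ℝ × ℝ) 1) (hq : q ∈ Set.Icc (0 : ℝ × ℝ) 1) (i : Fin d) :
    IndepFun (fun ω => W p ω - W q ω - EuclideanSpace.single i (W p ω i - W q ω i))
      (fun ω => W p ω i - W q ω i) P := by
  have hmc : ∀ p i, Measurable fun ω => W p ω i := hW.measurable_coord
  have hi := IsGaussianProcess.indepFun_of_covariance_eq_zero (P := P)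
    (X := fun (j : Fin d) ω => W (if j = i then q else p) ω j - W q ω j)
    (Y := fun (_ : Unit) ω => W p ω i - W q ω i) (by
      have := hW.isGaussianProcess_sub.comp_right (S := Fin d ⊕ Unit) (Sum.elim
        (fun j => ((if j = i then ⟨q, hq⟩ else ⟨p, hp⟩, ⟨q, hq⟩), j))
        (fun _ => ((⟨p, hp⟩, ⟨q, hq⟩), i)))
      refine this.congr ?_
      rintro (j | _)
      · by_cases h : j = i <;> simp [h]
      · exact .rfl)
    (fun j => ((hmc (if j = i then q else p) j).sub (hmc q j)).aemeasurable)
    (fun _ => ((hmc p i).sub (hmc q i)).aemeasurable)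
    (fun j z => by
      by_cases h : j = i
      · simp only [h, if_true, sub_self]
        exact covariance_const_left 0
      · simp only [h, if_false]
        rw [hW.covariance_sub hp hq hp hq, if_neg h])
  have hu : Measurable fun x : Unit → ℝ => x () := measurable_pi_apply ()
  have := hi.comp (φ := fun x : Fin d → ℝ => (WithLp.toLp 2 x : EuclideanSpace ℝ (Fin d)))
    (by fun_prop) hu
  convert this using 1
  · funext ω
    ext j
    by_cases h : j = i
    · subst h; simp
    · simp [h]
  · rfl

end Gaussian
section Smoothing

/-- Translation estimate: a bounded monotone function has total increment at most `2 B h`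
over shifts of length `h`. -/
lemma lintegral_shift_sub_le {φ : ℝ → ℝ} (hφ : Monotone φ) {B h : ℝ} (hB : ∀ x, |φ x| ≤ B)
    (hh : 0 < h) :
    ∫⁻ y, ENNReal.ofReal (φ (y + h) - φ y) ≤ ENNReal.ofReal (2 * B * h) := by
  have hφi : ∀ a b : ℝ, IntervalIntegrable φ volume a b := fun a b => hφ.intervalIntegrable
  have hmono : Monotone fun n : ℕ => Set.Ioc (-(n : ℝ)) n := fun m n hmn =>
    Set.Ioc_subset_Ioc (by simpa using hmn) (by simpa using hmn)
  have hU : (⋃ n : ℕ, Set.Ioc (-(n : ℝ)) n) = Set.univ := by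
    refine Set.eq_univ_of_forall fun x => ?_
    obtain ⟨n, hn⟩ := exists_nat_gt |x|
    rw [abs_lt] at hn
    exact Set.mem_iUnion.2 ⟨n, hn.1, hn.2.le⟩
  rw [← setLIntegral_univ, ← hU, setLIntegral_iUnion_of_directed _ hmono.directed_le]
  refine iSup_le fun n => ?_
  have hn : (-(n : ℝ)) ≤ n := by linarith [n.cast_nonneg (α := ℝ)]
  have hi2 : IntervalIntegrable (fun y => φ (y + h)) volume (-(n : ℝ)) n :=
    (hφ.comp (fun x y hxy => by simpa using hxy : Monotone fun y : ℝ => y + h)).intervalIntegrable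
  have hi := hi2.sub (hφi (-(n : ℝ)) n)
  rw [← ofReal_integral_eq_lintegral_ofReal
    ((intervalIntegrable_iff_integrableOn_Ioc_of_le hn).1 hi)
    (Eventually.of_forall fun y => sub_nonneg.2 (hφ (by linarith))),
    ← intervalIntegral.integral_of_le hn, intervalIntegral.integral_sub hi2 (hφi _ _),
    intervalIntegral.integral_comp_add_right]
  refine ENNReal.ofReal_le_ofReal ?_
  have e1 := intervalIntegral.integral_add_adjacent_intervals
    (hφi (-(n : ℝ) + h) n) (hφi n (n + h))
  have e2 := intervalIntegral.integral_add_adjacent_intervals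
    (hφi (-(n : ℝ)) (-n + h)) (hφi (-n + h) n)
  have b1 := intervalIntegral.norm_integral_le_of_norm_le_const (a := (n : ℝ)) (b := n + h)
    (f := φ) (C := B) fun x _ => hB x
  have b2 := intervalIntegral.norm_integral_le_of_norm_le_const (a := -(n : ℝ)) (b := -n + h)
    (f := φ) (C := B) fun x _ => hB x
  simp only [add_sub_cancel_left, abs_of_pos hh, Real.norm_eq_abs] at b1 b2
  rw [abs_le] at b1 b2
  linarith

/-- Gaussian smoothing of difference quotients of bounded monotone functions. -/
lemma lintegral_gaussianReal_diffQuot_le {φ : ℝ → ℝ} (hφ : Monotone φ) {B h v : ℝ}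
    (hB : ∀ x, |φ x| ≤ B) (hh : 0 < h) (hv : 0 < v) :
    ∫⁻ y, ENNReal.ofReal ((φ (y + h) - φ y) / h) ∂gaussianReal 0 v.toNNReal
      ≤ ENNReal.ofReal (B / √v) := by
  have hB0 : 0 ≤ B := (abs_nonneg _).trans (hB 0)
  have hm : Measurable fun y => ENNReal.ofReal (φ (y + h) - φ y) :=
    ((hφ.measurable.comp (measurable_id.add_const h)).sub hφ.measurable).ennreal_ofReal
  have hp : ∀ y, gaussianPDF 0 v.toNNReal y ≤ ENNReal.ofReal ((2 * √v)⁻¹) := fun y => by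
    refine ENNReal.ofReal_le_ofReal ?_
    rw [gaussianPDFReal, Real.coe_toNNReal _ hv.le]
    have h1 : Real.exp (-(y - 0) ^ 2 / (2 * v)) ≤ 1 := by
      rw [Real.exp_le_one_iff]
      exact div_nonpos_of_nonpos_of_nonneg (by nlinarith [sq_nonneg (y - 0)]) (by positivity)
    have h2 : 2 * √v ≤ √(2 * Real.pi * v) := by
      refine Real.le_sqrt_of_sq_le ?_
      rw [mul_pow, Real.sq_sqrt hv.le]
      nlinarith [Real.pi_gt_three]
    calc _ ≤ (√(2 * Real.pi * v))⁻¹ * 1 := by gcongr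
      _ ≤ _ := by rw [mul_one]; gcongr
  rw [gaussianReal_of_var_ne_zero _ (by simpa using hv),
    lintegral_withDensity_eq_lintegral_mul _ (measurable_gaussianPDF _ _) (by
      exact (((hφ.measurable.comp (measurable_id.add_const h)).sub
        hφ.measurable).div_const h).ennreal_ofReal)]
  calc _ ≤ ∫⁻ y, ENNReal.ofReal ((2 * √v)⁻¹) * (ENNReal.ofReal h⁻¹ *
        ENNReal.ofReal (φ (y + h) - φ y)) := by
        refine lintegral_mono fun y => ?_
        simp only [Pi.mul_apply]
        rw [div_eq_inv_mul, ENNReal.ofReal_mul (by positivity)]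
        gcongr
        exact hp y
    _ = ENNReal.ofReal ((2 * √v)⁻¹) * (ENNReal.ofReal h⁻¹ *
        ∫⁻ y, ENNReal.ofReal (φ (y + h) - φ y)) := by
        rw [lintegral_const_mul _ (hm.const_mul _), lintegral_const_mul _ hm]
    _ ≤ ENNReal.ofReal ((2 * √v)⁻¹) * (ENNReal.ofReal h⁻¹ * ENNReal.ofReal (2 * B * h)) := by
        gcongr
        exact lintegral_shift_sub_le hφ hB hh
    _ = _ := by
        rw [← ENNReal.ofReal_mul (by positivity), ← ENNReal.ofReal_mul (by positivity)]
        congr 1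
        field_simp

end Smoothing

/-- Integrating out an independent variable. -/
lemma ProbabilityTheory.IndepFun.lintegral_comp_le {Ω α β : Type*} [MeasurableSpace Ω]
    [MeasurableSpace α] [MeasurableSpace β] {P : Measure Ω} [IsProbabilityMeasure P]
    {X : Ω → α} {Y : Ω → β} (h : IndepFun X Y P) (hX : Measurable X) (hY : Measurable Y)
    {G : α → β → ENNReal} (hG : Measurable (Function.uncurry G)) {K : α → ENNReal}
    (hK : Measurable K) (hGK : ∀ a, ∫⁻ ω, G a (Y ω) ∂P ≤ K a) :
    ∫⁻ ω, G (X ω) (Y ω) ∂P ≤ ∫⁻ ω, K (X ω) ∂P := by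
  have : IsProbabilityMeasure (P.map Y) := Measure.isProbabilityMeasure_map hY.aemeasurable
  have h1 := (indepFun_iff_map_prod_eq_prod_map_map hX.aemeasurable hY.aemeasurable).1 h
  calc ∫⁻ ω, G (X ω) (Y ω) ∂P = ∫⁻ z, Function.uncurry G z ∂(P.map fun ω => (X ω, Y ω)) :=
        (lintegral_map hG (hX.prodMk hY)).symm
    _ = ∫⁻ a, ∫⁻ b, G a b ∂(P.map Y) ∂(P.map X) := by
        have : IsProbabilityMeasure (P.map X) := Measure.isProbabilityMeasure_map hX.aemeasurable
        rw [h1, lintegral_prod _ hG.aemeasurable]; rfl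
    _ ≤ ∫⁻ a, K a ∂(P.map X) := lintegral_mono fun a =>
        (lintegral_map (f := G a) (hG.comp measurable_prodMk_left) hY).trans_le (hGK a)
    _ = _ := lintegral_map hK hX

section Khasminskii

lemma Finset.prod_Ioc_one_add {R : Type*} [CommSemiring R] (c : ℕ → R) (N : ℕ) :
    ∀ a ≤ N, ∏ j ∈ Finset.Ioc a N, (1 + c j) =
      1 + ∑ j ∈ Finset.Ioc a N, c j * ∏ l ∈ Finset.Ioc j N, (1 + c l) := by
  intro a ha
  induction ha using Nat.decreasingInduction with
  | self => simp
  | of_succ a ha ih =>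
    rw [← Finset.insert_Ioc_succ_left_eq_Ioc (by exact ha : a < N), Finset.prod_insert (by simp),
      Finset.sum_insert (by simp)]
    simp only [Order.succ_eq_add_one]
    rw [add_mul, one_mul]
    nth_rw 1 [ih]
    ring

/-- A discretized Gamma integral bound. -/
lemma sum_exp_div_sqrt_le {lam : ℝ} (hl : 0 < lam) (n : ℕ) :
    ∑ m ∈ Finset.range n, Real.exp (-lam * (m + 1 : ℕ)) / √((m + 1 : ℕ) : ℝ) ≤ 3 / √lam := by
  set V : ℕ → ℝ := fun m => 2 * √(min (m : ℝ) lam⁻¹) - Real.exp (-lam * m) / √lam with hV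
  have hs : 0 < √lam := Real.sqrt_pos.2 hl
  have hstep : ∀ m : ℕ, Real.exp (-lam * (m + 1 : ℕ)) / √((m + 1 : ℕ) : ℝ) ≤ V (m + 1) - V m := by
    intro m
    have hm1 : (0 : ℝ) < (m + 1 : ℕ) := by positivity
    have hexp : Real.exp (-lam * (m + 1 : ℕ)) * √lam ≤
        (Real.exp (-lam * m) - Real.exp (-lam * (m + 1 : ℕ))) / √lam := by
      rw [le_div_iff₀ hs, mul_assoc, Real.mul_self_sqrt hl.le]
      have : Real.exp (-lam * m) = Real.exp (-lam * (m + 1 : ℕ)) * Real.exp lam := by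
        rw [← Real.exp_add]; push_cast; ring_nf
      rw [this]
      nlinarith [Real.exp_pos (-lam * (m + 1 : ℕ)), Real.add_one_le_exp lam]
    have hmin : √(min (m : ℝ) lam⁻¹) ≤ √(min ((m + 1 : ℕ) : ℝ) lam⁻¹) := by
      apply Real.sqrt_le_sqrt
      gcongr
      simp
    have hV' : V (m + 1) - V m = 2 * (√(min ((m + 1 : ℕ) : ℝ) lam⁻¹) - √(min (m : ℝ) lam⁻¹)) +
      (Real.exp (-lam * m) - Real.exp (-lam * (m + 1 : ℕ))) / √lam := by
      simp only [hV]; ring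
    rw [hV']
    rcases le_total ((m + 1 : ℕ) : ℝ) lam⁻¹ with hle | hle
    · have h2 : (m : ℝ) ≤ lam⁻¹ := le_trans (by simp) hle
      rw [min_eq_left hle, min_eq_left h2]
      have h3 : 0 ≤ (Real.exp (-lam * m) - Real.exp (-lam * (m + 1 : ℕ))) / √lam :=
        le_trans (by positivity) hexp
      have h4 : 1 / √((m + 1 : ℕ) : ℝ) ≤ 2 * (√((m + 1 : ℕ) : ℝ) - √(m : ℝ)) := by
        have hq := Real.sqrt_pos.2 hm1
        rw [div_le_iff₀ hq]
        have e1 := Real.sq_sqrt hm1.le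
        have e2 := Real.sq_sqrt (Nat.cast_nonneg (α := ℝ) m)
        push_cast at *
        nlinarith [sq_nonneg (√((m : ℝ) + 1) - √(m : ℝ))]
      have h5 : Real.exp (-lam * (m + 1 : ℕ)) / √((m + 1 : ℕ) : ℝ) ≤ 1 / √((m + 1 : ℕ) : ℝ) := by
        gcongr
        rw [Real.exp_le_one_iff]
        nlinarith
      linarith
    · have h6 : Real.exp (-lam * (m + 1 : ℕ)) / √((m + 1 : ℕ) : ℝ) ≤
          Real.exp (-lam * (m + 1 : ℕ)) * √lam := by
        rw [div_eq_mul_inv]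
        gcongr
        rw [← Real.sqrt_inv]
        apply Real.sqrt_le_sqrt
        exact inv_le_of_inv_le₀ hl hle
      linarith
  calc _ ≤ ∑ m ∈ Finset.range n, (V (m + 1) - V m) := Finset.sum_le_sum fun m _ => hstep m
    _ = V n - V 0 := Finset.sum_range_sub V n
    _ ≤ 3 / √lam := by
      have h1 : √(min (n : ℝ) lam⁻¹) ≤ 1 / √lam := by
        rw [one_div, ← Real.sqrt_inv]; exact Real.sqrt_le_sqrt (min_le_right _ _)
      have h2 : V 0 = - (1 / √lam) := by
        simp [hV, hl.le]
      have h3 : 0 ≤ Real.exp (-lam * n) / √lam := by positivity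
      have h4 : 3 / √lam = 3 * (1 / √lam) := by ring
      rw [h2, h4]
      simp only [hV]
      linarith

/-- A discrete Khasminskii lemma for partial sums with independent increments. -/
lemma lintegral_prod_one_add_le {Ω E : Type*} [MeasurableSpace Ω] [AddCommGroup E]
    [MeasurableSpace E] [MeasurableAdd₂ E] [MeasurableSub₂ E] {P : Measure Ω}
    [IsProbabilityMeasure P] {Y : ℕ → Ω → E} (hY : ∀ j, Measurable (Y j)) {N : ℕ}
    (hind : ∀ a j, a < j → j ≤ N →
      IndepFun (fun ω => Y j ω - Y a ω) (fun ω (l : ℕ) => Y (j + l) ω - Y j ω) P)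
    {G : ℕ → E → ENNReal} (hG : ∀ j, Measurable (G j)) {K lam : ℝ} (hK : 0 ≤ K) (hl : 0 < lam)
    (hKl : K * (3 / √lam) ≤ 1 / 2)
    (hGK : ∀ a j, a < j → j ≤ N → ∀ x,
      ∫⁻ ω, G j (x + (Y j ω - Y a ω)) ∂P ≤ ENNReal.ofReal (K / √((j - a : ℕ) : ℝ))) :
    ∀ a ≤ N, ∀ x, ∫⁻ ω, ∏ j ∈ Finset.Ioc a N, (1 + G j (x + (Y j ω - Y a ω))) ∂P ≤
      ENNReal.ofReal (2 * Real.exp (lam * (N - a : ℕ))) := by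
  suffices H : ∀ n a, a ≤ N → N - a = n → ∀ x,
      ∫⁻ ω, ∏ j ∈ Finset.Ioc a N, (1 + G j (x + (Y j ω - Y a ω))) ∂P ≤
      ENNReal.ofReal (2 * Real.exp (lam * (N - a : ℕ))) from fun a ha x => H _ a ha rfl x
  intro n
  induction n using Nat.strong_induction_on with
  | _ n ih =>
  intro a ha hn x
  have hmG : ∀ l, Measurable fun ω => G l (x + (Y l ω - Y a ω)) := fun l =>
    (hG l).comp (measurable_const.add ((hY l).sub (hY a)))
  have hterm : ∀ j ∈ Finset.Ioc a N, ∫⁻ ω, G j (x + (Y j ω - Y a ω)) *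
      ∏ l ∈ Finset.Ioc j N, (1 + G l (x + (Y l ω - Y a ω))) ∂P ≤
      ENNReal.ofReal (K / √((j - a : ℕ) : ℝ) * (2 * Real.exp (lam * (N - j : ℕ)))) := by
    intro j hj
    rw [Finset.mem_Ioc] at hj
    have hm1 : Measurable fun u => G j (x + u) := (hG j).comp (measurable_const.add measurable_id)
    have key := (hind a j hj.1 hj.2).lintegral_comp_le ((hY j).sub (hY a))
      (measurable_pi_lambda _ fun l => (hY (j + l)).sub (hY j))
      (G := fun u z => G j (x + u) * ∏ l ∈ Finset.Ioc j N, (1 + G l (x + u + z (l - j))))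
      (K := fun u => G j (x + u) * ENNReal.ofReal (2 * Real.exp (lam * (N - j : ℕ)))) (by
        refine (hm1.comp measurable_fst).mul (Finset.measurable_prod _ fun l _ => ?_)
        refine measurable_const.add ((hG l).comp ?_)
        exact (measurable_const.add measurable_fst).add
          ((measurable_pi_apply (l - j)).comp measurable_snd))
      (hm1.mul_const _) (by
        intro u
        have hmz : Measurable fun ω => ∏ l ∈ Finset.Ioc j N,
            (1 + G l (x + u + (Y (j + (l - j)) ω - Y j ω))) :=
          Finset.measurable_prod _ fun l _ => measurable_const.add ((hG l).comp
            (measurable_const.add ((hY _).sub (hY j))))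
        rw [lintegral_const_mul _ hmz]
        gcongr
        refine le_trans (le_of_eq ?_) (ih (N - j) (by omega) j hj.2 rfl (x + u))
        refine lintegral_congr fun ω => Finset.prod_congr rfl fun l hl => ?_
        rw [Finset.mem_Ioc] at hl
        rw [Nat.add_sub_cancel' hl.1.le])
    calc _ = _ := by
          refine lintegral_congr fun ω => ?_
          congr 1
          refine Finset.prod_congr rfl fun l hl => ?_
          rw [Finset.mem_Ioc] at hl
          dsimp only
          rw [Nat.add_sub_cancel' hl.1.le, add_assoc, add_comm (Y j ω - Y a ω),
            sub_add_sub_cancel]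
      _ ≤ _ := key
      _ ≤ _ := by
          rw [lintegral_mul_const _ (hmG j),
            ENNReal.ofReal_mul (p := K / √((j - a : ℕ) : ℝ)) (by positivity)]
          exact mul_le_mul' (hGK a j hj.1 hj.2 x) le_rfl
  have hsum : ∑ j ∈ Finset.Ioc a N, K / √((j - a : ℕ) : ℝ) *
      (2 * Real.exp (lam * (N - j : ℕ))) ≤ Real.exp (lam * (N - a : ℕ)) := by
    have hI : Finset.Ioc a N = Finset.Ico (a + 1) (N + 1) := by
      ext; simp only [Finset.mem_Ioc, Finset.mem_Ico]; omega
    rw [hI, Finset.sum_Ico_eq_sum_range]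
    calc _ = ∑ m ∈ Finset.range (N - a), 2 * Real.exp (lam * (N - a : ℕ)) * K *
          (Real.exp (-lam * (m + 1 : ℕ)) / √((m + 1 : ℕ) : ℝ)) := by
          rw [Nat.add_sub_add_right]
          refine Finset.sum_congr rfl fun m hm => ?_
          rw [Finset.mem_range] at hm
          have e1 : a + 1 + m - a = m + 1 := by omega
          have e2 : Real.exp (lam * (N - (a + 1 + m) : ℕ)) =
              Real.exp (lam * (N - a : ℕ)) * Real.exp (-lam * (m + 1 : ℕ)) := by
            rw [← Real.exp_add]
            have : ((N - a : ℕ) : ℝ) = (N - (a + 1 + m) : ℕ) + (m + 1 : ℕ) := by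
              rw [← Nat.cast_add]; congr 1; omega
            rw [this]; ring_nf
          rw [e1, e2]; ring
      _ ≤ 2 * Real.exp (lam * (N - a : ℕ)) * K * (3 / √lam) := by
          rw [← Finset.mul_sum]
          gcongr
          exact sum_exp_div_sqrt_le hl _
      _ ≤ _ := by nlinarith [Real.exp_pos (lam * (N - a : ℕ))]
  calc ∫⁻ ω, ∏ j ∈ Finset.Ioc a N, (1 + G j (x + (Y j ω - Y a ω))) ∂P
      = ∫⁻ ω, 1 + ∑ j ∈ Finset.Ioc a N, G j (x + (Y j ω - Y a ω)) *
        ∏ l ∈ Finset.Ioc j N, (1 + G l (x + (Y l ω - Y a ω))) ∂P :=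
        lintegral_congr fun ω => Finset.prod_Ioc_one_add _ N a ha
    _ = 1 + ∑ j ∈ Finset.Ioc a N, ∫⁻ ω, G j (x + (Y j ω - Y a ω)) *
        ∏ l ∈ Finset.Ioc j N, (1 + G l (x + (Y l ω - Y a ω))) ∂P := by
        rw [lintegral_add_left measurable_const, lintegral_finsetSum]
        · simp
        · exact fun j _ => (hmG j).mul
            (Finset.measurable_prod _ fun l _ => measurable_const.add (hmG l))
    _ ≤ 1 + ∑ j ∈ Finset.Ioc a N, ENNReal.ofReal (K / √((j - a : ℕ) : ℝ) *
        (2 * Real.exp (lam * (N - j : ℕ)))) := by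
        exact add_le_add_right (Finset.sum_le_sum hterm) 1
    _ = ENNReal.ofReal (1 + ∑ j ∈ Finset.Ioc a N, K / √((j - a : ℕ) : ℝ) *
        (2 * Real.exp (lam * (N - j : ℕ)))) := by
        rw [ENNReal.ofReal_add zero_le_one (Finset.sum_nonneg fun j _ => by positivity),
          ENNReal.ofReal_one, ENNReal.ofReal_sum_of_nonneg fun j _ => by positivity]
    _ ≤ _ := by
        refine ENNReal.ofReal_le_ofReal ?_
        have : 1 ≤ Real.exp (lam * (N - a : ℕ)) := Real.one_le_exp (by positivity)
        linarith

end Khasminskii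

section Line

variable {Ω : Type*} [MeasurableSpace Ω] {P : Measure Ω} {d : ℕ}
  {W : ℝ × ℝ → Ω → EuclideanSpace ℝ (Fin d)}

/-- The difference quotient of `φ` with step `h` in the `i`-th coordinate direction. -/
def diffQuot (φ : EuclideanSpace ℝ (Fin d) → ℝ) (i : Fin d) (h : ℝ)
    (x : EuclideanSpace ℝ (Fin d)) : ℝ :=
  (φ (x + EuclideanSpace.single i h) - φ x) / h

lemma diffQuot_nonneg {φ : EuclideanSpace ℝ (Fin d) → ℝ}
    (hmono : ∀ x y : EuclideanSpace ℝ (Fin d), (∀ i, x i ≤ y i) → φ x ≤ φ y) (i : Fin d) {h : ℝ}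
    (hh : 0 < h) (x : EuclideanSpace ℝ (Fin d)) : 0 ≤ diffQuot φ i h x := by
  refine div_nonneg (sub_nonneg.2 (hmono _ _ fun j => ?_)) hh.le
  rw [PiLp.add_apply, PiLp.single_apply]
  split_ifs <;> linarith

lemma diffQuot_le {φ : EuclideanSpace ℝ (Fin d) → ℝ} {B : ℝ} (hB : ∀ x, |φ x| ≤ B) (i : Fin d)
    {h : ℝ} (hh : 0 < h) (x : EuclideanSpace ℝ (Fin d)) : diffQuot φ i h x ≤ 2 * B / h := by
  unfold diffQuot
  gcongr
  have h1 := abs_le.1 (hB x)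
  have h2 := abs_le.1 (hB (x + EuclideanSpace.single i h))
  linarith

lemma Continuous.diffQuot {φ : EuclideanSpace ℝ (Fin d) → ℝ} (hφ : Continuous φ) (i : Fin d)
    (h : ℝ) : Continuous (diffQuot φ i h) :=
  ((hφ.comp (continuous_id.add continuous_const)).sub hφ).div_const h

/-- Smoothing of difference quotients by the increment of a Brownian sheet along a line. -/
lemma IsBrownianSheet.lintegral_diffQuot_le [IsProbabilityMeasure P] (hW : IsBrownianSheet P d W)
    {φ : EuclideanSpace ℝ (Fin d) → ℝ} (hφ : Continuous φ)
    (hmono : ∀ x y : EuclideanSpace ℝ (Fin d), (∀ i, x i ≤ y i) → φ x ≤ φ y)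
    {B : ℝ} (hB : ∀ x, |φ x| ≤ B) {h : ℝ} (hh : 0 < h) {a b τ : ℝ} (ha : 0 ≤ a) (hab : a < b)
    (hb : b ≤ 1) (hτ : 0 < τ) (hτ' : τ ≤ 1) (i : Fin d) (z : EuclideanSpace ℝ (Fin d)) :
    ∫⁻ ω, ENNReal.ofReal (diffQuot φ i h (z + (W (b, τ) ω - W (a, τ) ω))) ∂P ≤
      ENNReal.ofReal (B / √((b - a) * τ)) := by
  have hp : (b, τ) ∈ Set.Icc (0 : ℝ × ℝ) 1 := ⟨⟨ha.trans hab.le, hτ.le⟩, ⟨hb, hτ'⟩⟩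
  have hq : (a, τ) ∈ Set.Icc (0 : ℝ × ℝ) 1 := ⟨⟨ha, hτ.le⟩, ⟨hab.le.trans hb, hτ'⟩⟩
  have hc : Continuous fun y : ℝ => (EuclideanSpace.single i y : EuclideanSpace ℝ (Fin d)) := by
    have : (fun y : ℝ => (EuclideanSpace.single i y : EuclideanSpace ℝ (Fin d))) =
        fun y => y • EuclideanSpace.single i (1 : ℝ) := by
      funext y; ext j; simp [PiLp.single_apply]
    rw [this]
    exact continuous_id.smul continuous_const
  have hY : Measurable fun ω => W (b, τ) ω i - W (a, τ) ω i :=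
    (hW.measurable_coord _ i).sub (hW.measurable_coord _ i)
  have hX : Measurable fun ω => W (b, τ) ω - W (a, τ) ω -
      EuclideanSpace.single i (W (b, τ) ω i - W (a, τ) ω i) :=
    ((hW.1 _).sub (hW.1 _)).sub (hc.measurable.comp hY)
  have hGc : Continuous (Function.uncurry fun (v : EuclideanSpace ℝ (Fin d)) (y : ℝ) =>
      diffQuot φ i h (z + (v + EuclideanSpace.single i y))) :=
    (hφ.diffQuot i h).comp (continuous_const.add
      (continuous_fst.add (hc.comp continuous_snd)))
  have hfib : ∀ v : EuclideanSpace ℝ (Fin d), ∫⁻ ω, ENNReal.ofReal (diffQuot φ i h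
      (z + (v + EuclideanSpace.single i (W (b, τ) ω i - W (a, τ) ω i)))) ∂P ≤
      ENNReal.ofReal (B / √((b - a) * τ)) := fun v => by
    have hGv : Measurable fun y : ℝ => ENNReal.ofReal
        (diffQuot φ i h (z + (v + EuclideanSpace.single i y))) :=
      ((hφ.diffQuot i h).comp (continuous_const.add
        (continuous_const.add hc))).measurable.ennreal_ofReal
    have hl := lintegral_map (μ := P) hGv hY
    rw [← hl, hW.map_sub ha hab.le hb hτ.le hτ' i]
    have := lintegral_gaussianReal_diffQuot_le
      (φ := fun y => φ (z + (v + EuclideanSpace.single i y))) (B := B) (h := h)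
      (v := (b - a) * τ) (fun y y' hy => hmono _ _ fun j => by
        simp only [PiLp.add_apply, PiLp.single_apply]
        split_ifs <;> linarith) (fun y => hB _) hh (mul_pos (sub_pos.2 hab) hτ)
    refine le_trans (le_of_eq ?_) this
    refine lintegral_congr fun y => ?_
    have hs : (EuclideanSpace.single i (y + h) : EuclideanSpace ℝ (Fin d)) =
        EuclideanSpace.single i y + EuclideanSpace.single i h := by
      ext j; simp only [PiLp.add_apply, PiLp.single_apply]; split_ifs <;> simp
    rw [diffQuot, add_assoc z, add_assoc v, hs]
  have hind := hW.indepFun_coord hp hq i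
  have key := hind.lintegral_comp_le hX hY
    (G := fun v y => ENNReal.ofReal (diffQuot φ i h (z + (v + EuclideanSpace.single i y))))
    (K := fun _ => ENNReal.ofReal (B / √((b - a) * τ))) hGc.measurable.ennreal_ofReal
    measurable_const hfib
  simp only [sub_add_cancel, lintegral_const, measure_univ, mul_one] at key
  exact key

/-- Uniform exponential bound for Riemann sums along a line. -/
lemma IsBrownianSheet.lintegral_exp_sum_le [IsProbabilityMeasure P] (hW : IsBrownianSheet P d W)
    {f : ℝ × ℝ → EuclideanSpace ℝ (Fin d) → ℝ} (hf : ∀ p, Continuous (f p))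
    (hmono : ∀ p (x y : EuclideanSpace ℝ (Fin d)), (∀ i, x i ≤ y i) → f p x ≤ f p y)
    {B : ℝ} (hB : ∀ p x, |f p x| ≤ B) {h : ℝ} (hh : 0 < h) {k : ℝ} (hk : 0 ≤ k) {r s τ : ℝ}
    (hr : 0 < r) (hrs : r < s) (hs : s ≤ 1) (hτ : 0 < τ) (hτ' : τ ≤ 1) (i : Fin d) {N : ℕ}
    (hN : N ≠ 0)
    (hsmall : 2 * k * √τ / √(s - r) * ((s - r) / N) * (2 * B / h) ≤ 1) :
    ∫⁻ ω, ENNReal.ofReal (Real.exp (2 * k * √τ / √(s - r) * ((s - r) / N *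
      ∑ j ∈ Finset.Ioc 0 N, diffQuot (f (r + j * ((s - r) / N), τ)) i h
        (W (r + j * ((s - r) / N), τ) ω)))) ∂P ≤
      ENNReal.ofReal (2 * Real.exp ((24 * k * B) ^ 2 + 1)) := by
  have hB0 : 0 ≤ B := (abs_nonneg _).trans (hB 0 0)
  have hN0 : (0 : ℝ) < N := by positivity
  set δ : ℝ := (s - r) / N with hδ
  set c : ℝ := 2 * k * √τ / √(s - r) with hc
  set L : ℝ := (24 * k * B) ^ 2 + 1 with hL
  have hδ0 : 0 < δ := div_pos (by linarith) hN0
  have hc0 : 0 ≤ c := by positivity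
  have hδN : N * δ = s - r := by rw [hδ]; field_simp
  set T : ℕ → ℝ := fun j => if j = 0 then 0 else min 1 (r + j * δ) with hT
  have hTle : ∀ j, T j ≤ 1 := fun j => by simp only [hT]; split_ifs <;> simp
  have hT0 : ∀ j, 0 ≤ T j := fun j => by
    simp only [hT]; split_ifs
    · exact le_rfl
    · exact le_min zero_le_one (by positivity)
  have hTmono : Monotone T := fun a b hab => by
    rcases Nat.eq_zero_or_pos a with rfl | ha
    · exact (by simp [hT] : T 0 = 0).trans_le (hT0 b)
    · simp only [hT, ha.ne', (ha.trans_le hab).ne', if_false]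
      have : (a : ℝ) ≤ b := by exact_mod_cast hab
      gcongr
  have hTeq : ∀ j, 0 < j → j ≤ N → T j = r + j * δ := fun j hj hjN => by
    simp only [hT, hj.ne', if_false]
    refine min_eq_right ?_
    have : (j : ℝ) * δ ≤ N * δ := by gcongr
    linarith
  have hTsub : ∀ a j, a < j → j ≤ N → ((j - a : ℕ) : ℝ) * δ ≤ T j - T a := fun a j haj hj => by
    rw [hTeq j (by omega) hj, Nat.cast_sub haj.le]
    rcases Nat.eq_zero_or_pos a with rfl | ha
    · simp [hT]; linarith
    · rw [hTeq a ha (by omega)]; linarith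
  have hsr : 0 < √(s - r) := Real.sqrt_pos.2 (by linarith)
  have hsN : 0 < √(N : ℝ) := Real.sqrt_pos.2 hN0
  have hsτ : 0 < √τ := Real.sqrt_pos.2 hτ
  have hsδ : √δ = √(s - r) / √N := Real.sqrt_div (by linarith) _
  have hsδ0 : 0 < √δ := Real.sqrt_pos.2 hδ0
  have key := lintegral_prod_one_add_le (P := P) (Y := fun j => W (T j, τ)) (fun j => hW.1 _)
    (N := N) (fun a j haj hj => hW.indepFun_sub (hT0 a) (hTmono haj.le) (hTle j) hτ.le hτ'
      (c := fun l => T (j + l)) (fun l => hTmono (by omega)) fun l => hTle _)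
    (G := fun j x => ENNReal.ofReal (2 * (c * δ) * diffQuot (f (T j, τ)) i h x))
    (fun j => (((hf _).diffQuot i h).measurable.const_mul _).ennreal_ofReal)
    (K := 4 * k * B / √N) (lam := L / N) (by positivity) (by positivity) (by
      have h1 : 24 * k * B ≤ √L := Real.le_sqrt_of_sq_le (by simp [hL])
      have h2 : 0 < √L := Real.sqrt_pos.2 (by positivity)
      rw [Real.sqrt_div (by positivity)]
      have : 4 * k * B / √N * (3 / (√L / √N)) = 12 * k * B / √L := by field_simp; ring
      rw [this, div_le_iff₀ h2]
      linarith)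
    (fun a j haj hj x => by
      have hTa : T a < T j := by
        have h1 := hTsub a j haj hj
        have : (0 : ℝ) < (j - a : ℕ) := by exact_mod_cast Nat.sub_pos_of_lt haj
        nlinarith
      have hm := hW.lintegral_diffQuot_le (hf (T j, τ)) (hmono _) (hB _) hh (hT0 a) hTa (hTle j)
        hτ hτ' i x
      have hma : (0 : ℝ) < (j - a : ℕ) := by exact_mod_cast Nat.sub_pos_of_lt haj
      have hsm : 0 < √((j - a : ℕ) : ℝ) := Real.sqrt_pos.2 hma
      have hX : √((j - a : ℕ) : ℝ) * √δ * √τ ≤ √((T j - T a) * τ) := by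
        rw [← Real.sqrt_mul hma.le, ← Real.sqrt_mul (by positivity)]
        gcongr
        exact hTsub a j haj hj
      calc _ = ENNReal.ofReal (2 * (c * δ)) * ∫⁻ ω, ENNReal.ofReal
            (diffQuot (f (T j, τ)) i h (x + (W (T j, τ) ω - W (T a, τ) ω))) ∂P := by
            have hm' : Measurable fun ω => ENNReal.ofReal
                (diffQuot (f (T j, τ)) i h (x + (W (T j, τ) ω - W (T a, τ) ω))) :=
              (((hf _).diffQuot i h).measurable.comp
                (measurable_const.add ((hW.1 _).sub (hW.1 _)))).ennreal_ofReal
            rw [← lintegral_const_mul _ hm']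
            refine lintegral_congr fun ω => ?_
            rw [ENNReal.ofReal_mul (by positivity)]
        _ ≤ ENNReal.ofReal (2 * (c * δ)) * ENNReal.ofReal (B / √((T j - T a) * τ)) := by gcongr
        _ = ENNReal.ofReal (2 * (c * δ) * (B / √((T j - T a) * τ))) :=
            (ENNReal.ofReal_mul (by positivity)).symm
        _ ≤ ENNReal.ofReal (2 * (c * δ) * (B / (√((j - a : ℕ) : ℝ) * √δ * √τ))) := by gcongr
        _ = _ := by
            congr 1
            rw [show 2 * (c * δ) = 2 * (c * (√δ * √δ)) by rw [Real.mul_self_sqrt hδ0.le], hc, hsδ]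
            field_simp
            ring)
    0 (Nat.zero_le N) 0
  have hY0 : ∀ ω, W (T 0, τ) ω = 0 := fun ω =>
    hW.2.2.1 ω _ ⟨⟨hT0 0, hτ.le⟩, ⟨hTle 0, hτ'⟩⟩ (Or.inl (by simp [hT]))
  calc _ ≤ ∫⁻ ω, ∏ j ∈ Finset.Ioc 0 N, (1 + ENNReal.ofReal (2 * (c * δ) *
        diffQuot (f (T j, τ)) i h (0 + (W (T j, τ) ω - W (T 0, τ) ω)))) ∂P := by
        refine lintegral_mono fun ω => ?_
        simp only [hY0, sub_zero, zero_add]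
        rw [Finset.mul_sum, Finset.mul_sum, Real.exp_sum,
          ENNReal.ofReal_prod_of_nonneg fun _ _ => (Real.exp_pos _).le]
        refine Finset.prod_le_prod' fun j hj => ?_
        rw [Finset.mem_Ioc] at hj
        rw [hTeq j hj.1 hj.2]
        set g := diffQuot (f (r + j * δ, τ)) i h (W (r + j * δ, τ) ω) with hg
        have hg0 : 0 ≤ g := diffQuot_nonneg (hmono _) i hh _
        have hg1 : g ≤ 2 * B / h := diffQuot_le (hB _) i hh _
        have hx0 : 0 ≤ c * (δ * g) := by positivity
        have hx1 : c * (δ * g) ≤ 1 := by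
          refine le_trans ?_ hsmall
          rw [← mul_assoc]
          gcongr
        have hexp := Real.abs_exp_sub_one_le (x := c * (δ * g)) (by rwa [abs_of_nonneg hx0])
        rw [abs_of_nonneg hx0] at hexp
        rw [← ENNReal.ofReal_one, ← ENNReal.ofReal_add zero_le_one (by positivity)]
        refine ENNReal.ofReal_le_ofReal ?_
        have := (abs_le.1 hexp).2
        nlinarith
    _ ≤ _ := key
    _ = _ := by
        congr 3
        rw [Nat.sub_zero]
        field_simp

end Line

section Integrals

/-- Riemann sums of a continuous function converge to its integral. -/
lemma tendsto_riemannSum {φ : ℝ → ℝ} (hφ : Continuous φ) {r s : ℝ} (hrs : r < s) :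
    Tendsto (fun N : ℕ => (s - r) / N * ∑ j ∈ Finset.Ioc 0 N, φ (r + j * ((s - r) / N))) atTop
      (nhds (∫ x in r..s, φ x)) := by
  rw [Metric.tendsto_nhds]
  intro ε hε
  have hsr : 0 < s - r := sub_pos.2 hrs
  obtain ⟨η, hη, H⟩ := Metric.uniformContinuousOn_iff.1
    (isCompact_Icc.uniformContinuousOn_of_continuous hφ.continuousOn (s := Set.Icc r s))
    (ε / (2 * (s - r))) (by positivity)
  obtain ⟨N₀, hN₀⟩ := exists_nat_gt ((s - r) / η)
  filter_upwards [eventually_ge_atTop (max N₀ 1)] with N hN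
  have hN1 : (1 : ℝ) ≤ N := by exact_mod_cast (le_max_right _ _).trans hN
  have hNpos : (0 : ℝ) < N := by linarith
  have hN0' : (N₀ : ℝ) ≤ N := by exact_mod_cast (le_max_left _ _).trans hN
  set δ := (s - r) / N with hδ
  have hδ0 : 0 < δ := by positivity
  have hδη : δ < η := by
    rw [hδ, div_lt_iff₀ hNpos]
    rw [div_lt_iff₀ hη] at hN₀
    nlinarith
  have hNδ : N * δ = s - r := by rw [hδ]; field_simp
  have hI := intervalIntegral.sum_integral_adjacent_intervals (μ := volume) (f := φ)
    (a := fun j : ℕ => r + j * δ) (n := N) fun j _ => hφ.intervalIntegrable _ _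
  have hend : r + N * δ = s := by linarith
  simp only [Nat.cast_zero, zero_mul, add_zero, hend] at hI
  have hsum : δ * ∑ j ∈ Finset.Ioc 0 N, φ (r + j * δ) =
      ∑ j ∈ Finset.range N, δ * φ (r + (j + 1 : ℕ) * δ) := by
    rw [Finset.mul_sum, show Finset.Ioc 0 N = Finset.Ico 1 (N + 1) by
      ext; simp only [Finset.mem_Ioc, Finset.mem_Ico]; omega, Finset.sum_Ico_eq_sum_range]
    simp [add_comm]
  rw [hsum, ← hI, Real.dist_eq, ← Finset.sum_sub_distrib]
  have hterm : ∀ j ∈ Finset.range N, |δ * φ (r + (j + 1 : ℕ) * δ) -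
      ∫ x in (r + j * δ)..(r + (j + 1 : ℕ) * δ), φ x| ≤ ε / (2 * (s - r)) * δ := by
    intro j hj
    rw [Finset.mem_range] at hj
    have hj1 : ((j + 1 : ℕ) : ℝ) * δ ≤ N * δ := by gcongr; exact_mod_cast hj
    have hjj : ((j + 1 : ℕ) : ℝ) * δ = j * δ + δ := by push_cast; ring
    have hj0 : 0 ≤ (j : ℝ) * δ := by positivity
    have hc : ∫ x in (r + j * δ)..(r + (j + 1 : ℕ) * δ), (φ (r + (j + 1 : ℕ) * δ) - φ x) =
        δ * φ (r + (j + 1 : ℕ) * δ) - ∫ x in (r + j * δ)..(r + (j + 1 : ℕ) * δ), φ x := by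
      rw [intervalIntegral.integral_sub (by simp) (hφ.intervalIntegrable _ _),
        intervalIntegral.integral_const, smul_eq_mul]
      congr 2
      linarith
    rw [← hc, ← Real.norm_eq_abs]
    refine (intervalIntegral.norm_integral_le_of_norm_le_const
      (C := ε / (2 * (s - r))) fun x hx => ?_).trans (le_of_eq ?_)
    · rw [Set.uIoc_of_le (by linarith)] at hx
      refine (H _ ⟨by linarith, by linarith⟩ _ ⟨by linarith [hx.1], by linarith [hx.2]⟩ ?_).le
      rw [Real.dist_eq, abs_lt]
      constructor <;> linarith [hx.1, hx.2]
    · congr 1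
      rw [abs_of_nonneg] <;> linarith
  calc _ ≤ ∑ j ∈ Finset.range N, |δ * φ (r + (j + 1 : ℕ) * δ) -
      ∫ x in (r + j * δ)..(r + (j + 1 : ℕ) * δ), φ x| := Finset.abs_sum_le_sum_abs _ _
    _ ≤ ∑ j ∈ Finset.range N, ε / (2 * (s - r)) * δ := Finset.sum_le_sum hterm
    _ = ε / 2 := by
      rw [Finset.sum_const, Finset.card_range, nsmul_eq_mul,
        show (N : ℝ) * (ε / (2 * (s - r)) * δ) = ε / (2 * (s - r)) * (N * δ) by ring, hNδ]
      field_simp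
    _ < ε := by linarith

lemma intervalIntegral_swap_of_continuous {F : ℝ → ℝ → ℝ} (hF : Continuous (Function.uncurry F))
    {a b c d : ℝ} (hab : a ≤ b) (hcd : c ≤ d) :
    ∫ x in a..b, ∫ y in c..d, F x y = ∫ y in c..d, ∫ x in a..b, F x y := by
  simp only [intervalIntegral.integral_of_le hcd]
  refine intervalIntegral_integral_swap ?_
  rw [Set.uIoc_of_le hab, Measure.prod_restrict]
  exact (hF.continuousOn.integrableOn_compact (isCompact_Icc.prod isCompact_Icc)).mono_set
    (Set.prod_mono Set.Ioc_subset_Icc_self Set.Ioc_subset_Icc_self)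

/-- Jensen's inequality for the exponential with respect to a continuous probability density. -/
lemma exp_intervalIntegral_mul_le {u t : ℝ} (hut : u ≤ t) {w G : ℝ → ℝ}
    (hw : ContinuousOn w (Set.Icc u t)) (hG : ContinuousOn G (Set.Icc u t))
    (hw0 : ∀ τ ∈ Set.Icc u t, 0 ≤ w τ) (hw1 : ∫ τ in u..t, w τ = 1) :
    Real.exp (∫ τ in u..t, w τ * G τ) ≤ ∫ τ in u..t, w τ * Real.exp (G τ) := by
  have hi : ∀ {g : ℝ → ℝ}, ContinuousOn g (Set.Icc u t) → IntervalIntegrable g volume u t :=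
    fun hg => ContinuousOn.intervalIntegrable (by rwa [Set.uIcc_of_le hut])
  set M := ∫ τ in u..t, w τ * G τ with hM
  have h1 : ∫ τ in u..t, (Real.exp M * (1 - M) * w τ + Real.exp M * (w τ * G τ)) =
      Real.exp M := by
    rw [intervalIntegral.integral_add ((hi hw).const_mul _)
      ((hi (g := fun τ => w τ * G τ) (hw.mul hG)).const_mul _),
      intervalIntegral.integral_const_mul, intervalIntegral.integral_const_mul, hw1, ← hM]
    ring
  rw [← h1]
  refine intervalIntegral.integral_mono_on hut
    (((hi hw).const_mul _).add ((hi (hw.mul hG)).const_mul _)) (hi (hw.mul hG.rexp)) fun τ hτ => ?_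
  have h2 := Real.add_one_le_exp (G τ - M)
  rw [Real.exp_sub, le_div_iff₀ (Real.exp_pos M)] at h2
  nlinarith [mul_le_mul_of_nonneg_left h2 (hw0 τ hτ)]

/-- The normalization of the density proportional to `1 / √τ`. -/
lemma integral_one_div_sqrt_density {u t : ℝ} (hu : 0 < u) (hut : u < t) :
    ∫ τ in u..t, 1 / (2 * √τ * (√t - √u)) = 1 := by
  have hd : 0 < √t - √u := sub_pos.2 (Real.sqrt_lt_sqrt hu.le hut)
  have hpos : ∀ τ ∈ Set.uIcc u t, 0 < τ := fun τ hτ => by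
    rw [Set.uIcc_of_le hut.le] at hτ; exact hu.trans_le hτ.1
  rw [intervalIntegral.integral_eq_sub_of_hasDerivAt (f := fun τ => √τ / (√t - √u))
    (fun τ hτ => ?_) (ContinuousOn.intervalIntegrable fun τ hτ => ?_)]
  · field_simp
  · have := (Real.hasDerivAt_sqrt (hpos τ hτ).ne').div_const (√t - √u)
    rwa [div_div] at this
  · have h1 := Real.sqrt_pos.2 (hpos τ hτ)
    refine ContinuousAt.continuousWithinAt (continuousAt_const.div ?_ (by positivity))
    fun_prop

/-- A Fatou bound. -/
lemma lintegral_le_of_liminf {Ω : Type*} [MeasurableSpace Ω] {P : Measure Ω}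
    {X : ℕ → Ω → ENNReal} {Z : Ω → ENNReal} {C : ENNReal} (hX : ∀ n, Measurable (X n))
    (hZ : ∀ ω, Z ω ≤ liminf (fun n => X n ω) atTop) (hC : ∀ᶠ n in atTop, ∫⁻ ω, X n ω ∂P ≤ C) :
    ∫⁻ ω, Z ω ∂P ≤ C :=
  (lintegral_mono hZ).trans <| (lintegral_liminf_le hX).trans <|
    liminf_le_of_frequently_le' hC.frequently

end Integrals

section Field

lemma continuous_intervalIntegral_fst {Ω : Type*} {Φ : ℝ × ℝ → Ω → ℝ}
    (hΦc : ∀ ω, Continuous fun p => Φ p ω) (r s : ℝ) (ω : Ω) :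
    Continuous fun y => ∫ x in r..s, Φ (x, y) ω :=
  intervalIntegral.continuous_parametric_intervalIntegral_of_continuous'
    (f := fun y x => Φ (x, y) ω) ((hΦc ω).comp continuous_swap) r s
variable {Ω : Type*} [MeasurableSpace Ω] {P : Measure Ω} {Φ : ℝ × ℝ → Ω → ℝ}

lemma measurable_intervalIntegral_fst (hΦc : ∀ ω, Continuous fun p => Φ p ω)
    (hΦm : ∀ p, Measurable (Φ p)) {r s : ℝ} (hrs : r ≤ s) (y : ℝ) :
    Measurable fun ω => ∫ x in r..s, Φ (x, y) ω := by
  simp only [intervalIntegral.integral_of_le hrs]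
  have hm : Measurable (Function.uncurry fun x ω => Φ (x, y) ω) :=
    measurable_uncurry_of_continuous_of_measurable
      (fun ω => (hΦc ω).comp (Continuous.prodMk_left y)) fun x => hΦm _
  exact (StronglyMeasurable.integral_prod_right (f := fun ω x => Φ (x, y) ω)
    (hm.comp measurable_swap).stronglyMeasurable).measurable

/-- Reduction of a two-parameter exponential bound to one-parameter bounds on lines. -/
lemma lintegral_exp_integral_integral_le [SFinite P] (hΦc : ∀ ω, Continuous fun p => Φ p ω)
    (hΦm : ∀ p, Measurable (Φ p)) (hΦ0 : ∀ p ω, 0 ≤ Φ p ω) {k r s u t : ℝ} (hk : 0 ≤ k)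
    (hrs : r < s) (hu : 0 < u) (hut : u < t) {C : ENNReal}
    (H : ∀ τ ∈ Set.Icc u t, ∫⁻ ω, ENNReal.ofReal (Real.exp
      (2 * k * √τ / √(s - r) * ∫ x in r..s, Φ (x, τ) ω)) ∂P ≤ C) :
    ∫⁻ ω, ENNReal.ofReal (Real.exp (k / (√(s - r) * √(t - u)) *
      ∫ x in r..s, ∫ y in u..t, Φ (x, y) ω)) ∂P ≤ C := by
  have hd : 0 < √t - √u := sub_pos.2 (Real.sqrt_lt_sqrt hu.le hut)
  have hsr : 0 < √(s - r) := Real.sqrt_pos.2 (sub_pos.2 hrs)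
  have htu : √t - √u ≤ √(t - u) := by
    refine Real.le_sqrt_of_sq_le ?_
    have h1 := Real.sq_sqrt hu.le
    have h2 := Real.sq_sqrt (hu.trans hut).le
    nlinarith [Real.sqrt_nonneg u]
  have hpos : ∀ τ ∈ Set.Icc u t, 0 < √τ := fun τ hτ => Real.sqrt_pos.2 (hu.trans_le hτ.1)
  set w : ℝ → ℝ := fun τ => 1 / (2 * √τ * (√t - √u)) with hw
  set G : ℝ → Ω → ℝ := fun τ ω => 2 * k * √τ / √(s - r) * ∫ x in r..s, Φ (x, τ) ω with hG
  have hwc : ContinuousOn w (Set.Icc u t) := fun τ hτ => by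
    have := hpos τ hτ
    refine ContinuousAt.continuousWithinAt (continuousAt_const.div ?_ (by positivity))
    fun_prop
  have hw0 : ∀ τ ∈ Set.Icc u t, 0 ≤ w τ := fun τ hτ => by
    have := hpos τ hτ
    simp only [hw]
    positivity
  have hwm : Measurable w := by
    simp only [hw]
    fun_prop
  have hGc : ∀ ω, Continuous fun τ => G τ ω := fun ω =>
    ((continuous_const.mul Real.continuous_sqrt).div_const _).mul
      (continuous_intervalIntegral_fst hΦc r s ω)
  have hGm : ∀ τ, Measurable (G τ) := fun τ =>
    (measurable_intervalIntegral_fst hΦc hΦm hrs.le τ).const_mul _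
  have hGu : Measurable (Function.uncurry G) :=
    measurable_uncurry_of_continuous_of_measurable hGc hGm
  have hle : ∀ ω, k / (√(s - r) * √(t - u)) * ∫ x in r..s, ∫ y in u..t, Φ (x, y) ω ≤
      ∫ τ in u..t, w τ * G τ ω := fun ω => by
    rw [intervalIntegral_swap_of_continuous (F := fun x y => Φ (x, y) ω) (hΦc ω) hrs.le hut.le,
      ← intervalIntegral.integral_const_mul]
    refine intervalIntegral.integral_mono_on hut.le
      (((continuous_intervalIntegral_fst hΦc r s ω).const_mul _).intervalIntegrable _ _)
      (ContinuousOn.intervalIntegrable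
        (by rw [Set.uIcc_of_le hut.le]; exact hwc.mul (hGc ω).continuousOn)) fun τ hτ => ?_
    have h1 := hpos τ hτ
    have h2 : 0 ≤ ∫ x in r..s, Φ (x, τ) ω :=
      intervalIntegral.integral_nonneg hrs.le fun x _ => hΦ0 _ _
    have h3 : w τ * G τ ω = k / (√(s - r) * (√t - √u)) * ∫ x in r..s, Φ (x, τ) ω := by
      simp only [hw, hG]
      field_simp
    rw [h3]
    gcongr
  calc _ ≤ ∫⁻ ω, (∫⁻ τ in Set.Ioc u t, ENNReal.ofReal (w τ * Real.exp (G τ ω))) ∂P := by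
        refine lintegral_mono fun ω => ?_
        have hcont : ContinuousOn (fun τ => w τ * Real.exp (G τ ω)) (Set.Icc u t) :=
          hwc.mul (hGc ω).rexp.continuousOn
        rw [← ofReal_integral_eq_lintegral_ofReal
          (hcont.integrableOn_Icc.mono_set Set.Ioc_subset_Icc_self)
          ((ae_restrict_mem measurableSet_Ioc).mono fun τ hτ =>
            mul_nonneg (hw0 τ (Set.Ioc_subset_Icc_self hτ)) (Real.exp_pos _).le),
          ← intervalIntegral.integral_of_le hut.le]
        refine ENNReal.ofReal_le_ofReal ((Real.exp_le_exp.2 (hle ω)).trans ?_)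
        exact exp_intervalIntegral_mul_le hut.le hwc (hGc ω).continuousOn hw0
          (integral_one_div_sqrt_density hu hut)
    _ = ∫⁻ τ in Set.Ioc u t, (∫⁻ ω, ENNReal.ofReal (w τ * Real.exp (G τ ω)) ∂P) :=
        lintegral_lintegral_swap (((hwm.comp measurable_snd).mul
          (hGu.comp measurable_swap).exp).ennreal_ofReal).aemeasurable
    _ ≤ ∫⁻ τ in Set.Ioc u t, ENNReal.ofReal (w τ) * C := by
        refine setLIntegral_mono (hwm.ennreal_ofReal.mul_const _) fun τ hτ => ?_
        have hτ' := Set.Ioc_subset_Icc_self hτ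
        simp only [ENNReal.ofReal_mul (hw0 τ hτ')]
        rw [lintegral_const_mul _ (hGm τ).exp.ennreal_ofReal]
        exact mul_le_mul' le_rfl (H τ hτ')
    _ = C := by
        rw [lintegral_mul_const _ hwm.ennreal_ofReal, ← ofReal_integral_eq_lintegral_ofReal
          (hwc.integrableOn_Icc.mono_set Set.Ioc_subset_Icc_self)
          ((ae_restrict_mem measurableSet_Ioc).mono fun τ hτ =>
            hw0 τ (Set.Ioc_subset_Icc_self hτ)),
          ← intervalIntegral.integral_of_le hut.le, integral_one_div_sqrt_density hu hut,
          ENNReal.ofReal_one, one_mul]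

end Field

section Field

variable {Ω : Type*} [MeasurableSpace Ω] {P : Measure Ω}

lemma le_liminf_ofReal_exp {κ L : ℝ} (hκ : 0 ≤ κ) {J : ℕ → ℝ} (hJ : ∀ n, 0 ≤ J n)
    (hL : ENNReal.ofReal L ≤ liminf (fun n => ENNReal.ofReal (J n)) atTop) :
    ENNReal.ofReal (Real.exp (κ * L)) ≤
      liminf (fun n => ENNReal.ofReal (Real.exp (κ * J n))) atTop := by
  have hcont : Tendsto (fun l => ENNReal.ofReal (Real.exp (κ * l))) (nhdsWithin L (Set.Iio L))
      (nhds (ENNReal.ofReal (Real.exp (κ * L)))) :=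
    ((ENNReal.continuous_ofReal.comp (Real.continuous_exp.comp
      (continuous_const.mul continuous_id))).tendsto L).mono_left nhdsWithin_le_nhds
  refine le_of_tendsto hcont (eventually_mem_nhdsWithin.mono fun l hl => ?_)
  refine le_liminf_of_le (by isBoundedDefault) ?_
  have hev : ∀ᶠ n in atTop, l ≤ J n := by
    rcases lt_or_ge l 0 with h0 | h0
    · exact Eventually.of_forall fun n => h0.le.trans (hJ n)
    · have : ENNReal.ofReal l < ENNReal.ofReal L :=
        (ENNReal.ofReal_lt_ofReal_iff (h0.trans_lt hl)).2 hl
      filter_upwards [eventually_lt_of_lt_liminf (this.trans_le hL)] with n hn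
      exact ((ENNReal.ofReal_lt_ofReal_iff_of_nonneg h0).1 hn).le
  filter_upwards [hev] with n hn
  gcongr

/-- Fatou's lemma for iterated interval integrals, without integrability of the limit. -/
lemma ofReal_integral_integral_le_liminf {F : ℕ → ℝ → ℝ → ℝ} {D : ℝ → ℝ → ℝ}
    (hF : ∀ n, Continuous (Function.uncurry (F n))) (hF0 : ∀ n x y, 0 ≤ F n x y)
    (hD : ∀ x y, Tendsto (fun n => F n x y) atTop (nhds (D x y))) {r s u t : ℝ} (hrs : r ≤ s)
    (hut : u ≤ t) :
    ENNReal.ofReal (∫ x in r..s, ∫ y in u..t, D x y) ≤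
      liminf (fun n => ENNReal.ofReal (∫ x in r..s, ∫ y in u..t, F n x y)) atTop := by
  have hD0 : ∀ x y, 0 ≤ D x y := fun x y => ge_of_tendsto' (hD x y) fun n => hF0 n x y
  have hofReal : ∀ {g : ℝ → ℝ} {a b : ℝ}, a ≤ b → (∀ x, 0 ≤ g x) →
      ENNReal.ofReal (∫ x in a..b, g x) ≤ ∫⁻ x in Set.Ioc a b, ENNReal.ofReal (g x) := by
    intro g a b hab hg
    rw [intervalIntegral.integral_of_le hab]
    have := enorm_integral_le_lintegral_enorm (μ := volume.restrict (Set.Ioc a b)) g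
    simp only [Real.enorm_of_nonneg (hg _),
      Real.enorm_of_nonneg (integral_nonneg hg : 0 ≤ ∫ x in Set.Ioc a b, g x)] at this
    exact this
  have heq : ∀ {g : ℝ → ℝ} {a b : ℝ}, a ≤ b → (∀ x, 0 ≤ g x) → Continuous g →
      ∫⁻ x in Set.Ioc a b, ENNReal.ofReal (g x) = ENNReal.ofReal (∫ x in a..b, g x) := by
    intro g a b hab hg hgc
    rw [intervalIntegral.integral_of_le hab, ofReal_integral_eq_lintegral_ofReal
      (hgc.integrableOn_Ioc) (Eventually.of_forall hg)]
  have hFx : ∀ n x, Continuous (F n x) := fun n x => (hF n).comp (Continuous.prodMk_right x)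
  have hFi : ∀ n, Continuous fun x => ∫ y in u..t, F n x y := fun n =>
    intervalIntegral.continuous_parametric_intervalIntegral_of_continuous' (hF n) u t
  have hFi0 : ∀ n x, 0 ≤ ∫ y in u..t, F n x y := fun n x =>
    intervalIntegral.integral_nonneg hut fun y _ => hF0 n x y
  calc _ ≤ ∫⁻ x in Set.Ioc r s, ENNReal.ofReal (∫ y in u..t, D x y) :=
        hofReal hrs fun x => intervalIntegral.integral_nonneg hut fun y _ => hD0 x y
    _ ≤ ∫⁻ x in Set.Ioc r s, liminf (fun n => ENNReal.ofReal (∫ y in u..t, F n x y)) atTop := by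
        refine lintegral_mono fun x => (hofReal hut (hD0 x)).trans ?_
        calc _ = ∫⁻ y in Set.Ioc u t, liminf (fun n => ENNReal.ofReal (F n x y)) atTop :=
              lintegral_congr fun y =>
                ((ENNReal.continuous_ofReal.tendsto _).comp (hD x y)).liminf_eq.symm
          _ ≤ liminf (fun n => ∫⁻ y in Set.Ioc u t, ENNReal.ofReal (F n x y)) atTop :=
              lintegral_liminf_le fun n => (hFx n x).measurable.ennreal_ofReal
          _ = _ := by simp only [heq hut (hF0 _ x) (hFx _ x)]
    _ ≤ liminf (fun n => ∫⁻ x in Set.Ioc r s, ENNReal.ofReal (∫ y in u..t, F n x y)) atTop :=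
        lintegral_liminf_le fun n => (hFi n).measurable.ennreal_ofReal
    _ = _ := by simp only [heq hrs (hFi0 _) (hFi _)]

end Field

section Sheet

lemma continuous_diffQuot_comp {d : ℕ} {w : ℝ × ℝ → EuclideanSpace ℝ (Fin d)}
    {f : ℝ × ℝ → EuclideanSpace ℝ (Fin d) → ℝ} (hw : Continuous w)
    (hf : Continuous (Function.uncurry f)) (i : Fin d) (h : ℝ) :
    Continuous fun p => diffQuot (f p) i h (w p) :=
  ((hf.comp (continuous_id.prodMk (hw.add continuous_const))).sub
    (hf.comp (continuous_id.prodMk hw))).div_const h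

variable {Ω : Type*} [MeasurableSpace Ω] {P : Measure Ω} [IsProbabilityMeasure P] {d : ℕ}
  {W : ℝ × ℝ → Ω → EuclideanSpace ℝ (Fin d)} {f : ℝ × ℝ → EuclideanSpace ℝ (Fin d) → ℝ}

/-- Exponential bound for integrals of difference quotients along a line. -/
lemma IsBrownianSheet.lintegral_exp_integral_le (hW : IsBrownianSheet P d W)
    (hWc : ∀ ω, Continuous fun p => W p ω) (hf : Continuous (Function.uncurry f))
    (hmono : ∀ p (x y : EuclideanSpace ℝ (Fin d)), (∀ i, x i ≤ y i) → f p x ≤ f p y)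
    {B : ℝ} (hB : ∀ p x, |f p x| ≤ B) {h : ℝ} (hh : 0 < h) {k : ℝ} (hk : 0 ≤ k) {r s τ : ℝ}
    (hr : 0 < r) (hrs : r < s) (hs : s ≤ 1) (hτ : 0 < τ) (hτ' : τ ≤ 1) (i : Fin d) :
    ∫⁻ ω, ENNReal.ofReal (Real.exp (2 * k * √τ / √(s - r) *
      ∫ x in r..s, diffQuot (f (x, τ)) i h (W (x, τ) ω))) ∂P ≤
      ENNReal.ofReal (2 * Real.exp ((24 * k * B) ^ 2 + 1)) := by
  have hfp : ∀ p, Continuous (f p) := fun p => hf.comp (Continuous.prodMk_right p)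
  have hm : ∀ p, Measurable fun ω => diffQuot (f p) i h (W p ω) := fun p =>
    ((hfp p).diffQuot i h).measurable.comp (hW.1 p)
  refine lintegral_le_of_liminf (X := fun N ω => ENNReal.ofReal (Real.exp
    (2 * k * √τ / √(s - r) * ((s - r) / N * ∑ j ∈ Finset.Ioc 0 N,
      diffQuot (f (r + j * ((s - r) / N), τ)) i h (W (r + j * ((s - r) / N), τ) ω)))))
    (fun N => ?_) (fun ω => ?_) ?_
  · exact ((Finset.measurable_sum _ fun j _ => hm _).const_mul _ |>.const_mul _).exp.ennreal_ofReal
  · have hc : Continuous fun x => diffQuot (f (x, τ)) i h (W (x, τ) ω) :=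
      (continuous_diffQuot_comp (hWc ω) hf i h).comp (Continuous.prodMk_left τ)
    have hcont : Continuous fun l : ℝ => ENNReal.ofReal (Real.exp (2 * k * √τ / √(s - r) * l)) :=
      ENNReal.continuous_ofReal.comp (Real.continuous_exp.comp
        (continuous_const.mul continuous_id))
    exact ((hcont.tendsto _).comp (tendsto_riemannSum hc hrs)).liminf_eq.ge
  · have hlim : Tendsto (fun N : ℕ => 2 * k * √τ / √(s - r) * ((s - r) / N) * (2 * B / h)) atTop
        (nhds 0) := by
      simpa using ((tendsto_const_div_atTop_nhds_zero_nat (s - r)).const_mul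
        (2 * k * √τ / √(s - r))).mul_const (2 * B / h)
    filter_upwards [hlim.eventually_le_const one_pos, eventually_ne_atTop 0] with N hN hN0
    exact hW.lintegral_exp_sum_le hfp hmono hB hh hk hr hrs hs hτ hτ' i hN0 hN

lemma tendsto_diffQuot {φ : EuclideanSpace ℝ (Fin d) → ℝ} (hφ : Differentiable ℝ φ) (i : Fin d)
    (x : EuclideanSpace ℝ (Fin d)) :
    Tendsto (fun n : ℕ => diffQuot φ i (1 / ((n : ℝ) + 1)) x) atTop
      (nhds (fderiv ℝ φ x (EuclideanSpace.single i 1))) := by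
  have h1 := ((hφ x).hasFDerivAt.hasLineDerivAt
    (EuclideanSpace.single i 1)).tendsto_slope_zero_right
  have h2 : Tendsto (fun n : ℕ => 1 / ((n : ℝ) + 1)) atTop (nhdsWithin 0 (Set.Ioi 0)) :=
    tendsto_nhdsWithin_iff.2 ⟨tendsto_one_div_add_atTop_nhds_zero_nat,
      Eventually.of_forall fun n => by simp only [Set.mem_Ioi]; positivity⟩
  refine (h1.comp h2).congr fun n => ?_
  have hs : (1 / ((n : ℝ) + 1)) • (EuclideanSpace.single i 1 : EuclideanSpace ℝ (Fin d)) =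
      EuclideanSpace.single i (1 / ((n : ℝ) + 1)) := by
    ext j; simp [PiLp.single_apply]
  rw [Function.comp_apply, hs, diffQuot, smul_eq_mul]
  exact (div_eq_inv_mul _ _).symm

/-- The exponential bound for globally continuous data. -/
lemma IsBrownianSheet.lintegral_exp_integral_fderiv_le (hW : IsBrownianSheet P d W)
    (hWc : ∀ ω, Continuous fun p => W p ω) (hf : Continuous (Function.uncurry f))
    (hdiff : ∀ p, Differentiable ℝ (f p))
    (hmono : ∀ p (x y : EuclideanSpace ℝ (Fin d)), (∀ i, x i ≤ y i) → f p x ≤ f p y)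
    {B : ℝ} (hB : ∀ p x, |f p x| ≤ B) {k : ℝ} (hk : 0 ≤ k) (i : Fin d) {r s u t : ℝ}
    (hr : 0 < r) (hrs : r < s) (hs : s ≤ 1) (hu : 0 < u) (hut : u < t) (ht : t ≤ 1) :
    ∫⁻ ω, ENNReal.ofReal (Real.exp (k / (√(s - r) * √(t - u)) * ∫ x in r..s, ∫ y in u..t,
      fderiv ℝ (f (x, y)) (W (x, y) ω) (EuclideanSpace.single i 1))) ∂P ≤
      ENNReal.ofReal (2 * Real.exp ((24 * k * B) ^ 2 + 1)) := by
  have hh : ∀ n : ℕ, 0 < 1 / ((n : ℝ) + 1) := fun n => by positivity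
  have hfp : ∀ p, Continuous (f p) := fun p => (hdiff p).continuous
  have hm : ∀ h p, Measurable fun ω => diffQuot (f p) i h (W p ω) := fun h p =>
    ((hfp p).diffQuot i h).measurable.comp (hW.1 p)
  have hc : ∀ (n : ℕ) ω,
      Continuous fun p => diffQuot (f p) i (1 / ((n : ℝ) + 1)) (W p ω) := fun n ω =>
    continuous_diffQuot_comp (hWc ω) hf i _
  have h0 : ∀ (n : ℕ) p ω, 0 ≤ diffQuot (f p) i (1 / ((n : ℝ) + 1)) (W p ω) := fun n p ω =>
    diffQuot_nonneg (hmono p) i (hh n) _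
  refine lintegral_le_of_liminf (X := fun n ω => ENNReal.ofReal (Real.exp
    (k / (√(s - r) * √(t - u)) * ∫ x in r..s, ∫ y in u..t,
      diffQuot (f (x, y)) i (1 / ((n : ℝ) + 1)) (W (x, y) ω)))) (fun n => ?_) (fun ω => ?_)
    (Eventually.of_forall fun n => ?_)
  · refine (Measurable.const_mul ?_ _).exp.ennreal_ofReal
    exact measurable_intervalIntegral_fst
      (Φ := fun p ω => ∫ y in u..t, diffQuot (f (p.1, y)) i (1 / ((n : ℝ) + 1)) (W (p.1, y) ω))
      (fun ω => (intervalIntegral.continuous_parametric_intervalIntegral_of_continuous'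
        (f := fun x y => diffQuot (f (x, y)) i (1 / ((n : ℝ) + 1)) (W (x, y) ω))
        (hc n ω) u t).comp continuous_fst)
      (fun p => measurable_intervalIntegral_fst
        (Φ := fun q ω => diffQuot (f q.swap) i (1 / ((n : ℝ) + 1)) (W q.swap ω))
        (fun ω => (hc n ω).comp continuous_swap) (fun q => hm _ _) hut.le p.1) hrs.le 0
  · exact le_liminf_ofReal_exp (by positivity)
      (fun n => intervalIntegral.integral_nonneg hrs.le fun x _ =>
        intervalIntegral.integral_nonneg hut.le fun y _ => h0 n _ _)
      (ofReal_integral_integral_le_liminf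
        (F := fun n x y => diffQuot (f (x, y)) i (1 / ((n : ℝ) + 1)) (W (x, y) ω))
        (fun n => hc n ω) (fun n x y => h0 n _ _)
        (fun x y => tendsto_diffQuot (hdiff _) i _) hrs.le hut.le)
  · exact lintegral_exp_integral_integral_le
      (Φ := fun p ω => diffQuot (f p) i (1 / ((n : ℝ) + 1)) (W p ω)) (hc n) (hm _) (h0 n) hk hrs
      hu hut fun τ hτ => hW.lintegral_exp_integral_le hWc hf hmono hB (hh n) hk hr hrs hs
        (hu.trans_le hτ.1) (hτ.2.trans ht) i

end Sheet

/-- exponential moment estimate for averaged spatial partial derivatives of a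
bounded, componentwise nondecreasing, `C¹`-in-space function along the sheet. -/
theorem statement12 {Ω : Type*} [MeasurableSpace Ω] (P : Measure Ω) [IsProbabilityMeasure P]
    (d : ℕ) (W : ℝ × ℝ → Ω → EuclideanSpace ℝ (Fin d)) (hW : IsBrownianSheet P d W) :
    ∃ C : ℝ → ℝ → ℝ,
      (∀ k K : ℝ, 0 ≤ k → 0 ≤ K → 0 < C k K) ∧
      (∀ k k' K K' : ℝ, 0 ≤ k → k ≤ k' → 0 ≤ K → K ≤ K' → C k K ≤ C k' K') ∧
      ∀ f : ℝ × ℝ → EuclideanSpace ℝ (Fin d) → ℝ,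
        ContinuousOn (fun q : (ℝ × ℝ) × EuclideanSpace ℝ (Fin d) => f q.1 q.2)
          (Set.Icc (0 : ℝ × ℝ) 1 ×ˢ Set.univ) →
        (∀ p, ContDiff ℝ 1 (f p)) →
        (∀ p (x y : EuclideanSpace ℝ (Fin d)), (∀ i, x i ≤ y i) → f p x ≤ f p y) →
        ∀ B : ℝ, (∀ p x, |f p x| ≤ B) →
        ∀ k : ℝ, 0 ≤ k → ∀ i : Fin d,
        ∀ r s u t : ℝ, 0 < r → r < s → s ≤ 1 → 0 < u → u < t → t ≤ 1 →
          ∫⁻ ω, ENNReal.ofReal (Real.exp ((k / (Real.sqrt (s - r) * Real.sqrt (t - u))) *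
              ∫ s₁ in r..s, ∫ t₁ in u..t,
                fderiv ℝ (f (s₁, t₁)) (W (s₁, t₁) ω) (EuclideanSpace.single i 1))) ∂P
            ≤ ENNReal.ofReal (C k B) := by
  refine ⟨fun k B => 2 * Real.exp ((24 * k * B) ^ 2 + 1), fun _ _ _ _ => by positivity,
    fun k k' K K' hk hkk hK hKK => ?_, fun f hf hC1 hmono B hB k hk i r s u t hr hrs hs hu hut ht
      => ?_⟩
  · have := hk.trans hkk
    simp only
    gcongr
  set π : ℝ × ℝ → ℝ × ℝ := fun p => (min (max 0 p.1) 1, min (max 0 p.2) 1) with hπ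
  have hπc : Continuous π := by fun_prop
  have hπm : ∀ p, π p ∈ Set.Icc (0 : ℝ × ℝ) 1 := fun p =>
    ⟨⟨le_min (le_max_left _ _) zero_le_one, le_min (le_max_left _ _) zero_le_one⟩,
      ⟨min_le_right _ _, min_le_right _ _⟩⟩
  have hπe : ∀ p ∈ Set.Icc (0 : ℝ × ℝ) 1, π p = p := fun p hp =>
    Prod.ext ((congrArg (min · 1) (max_eq_right hp.1.1)).trans (min_eq_left hp.2.1))
      ((congrArg (min · 1) (max_eq_right hp.1.2)).trans (min_eq_left hp.2.2))
  have hW' : IsBrownianSheet P d fun p => W (π p) := by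
    refine ⟨fun p => hW.1 _, fun ω => (hW.2.1 ω).comp hπc.continuousOn fun p _ => hπm p,
      fun ω p hp h => ?_, fun n p idx c hp => ?_⟩
    · simp only [hπe p hp]
      exact hW.2.2.1 ω p hp h
    · simp only [hπe _ (hp _)]
      exact hW.2.2.2 n p idx c hp
  have key := hW'.lintegral_exp_integral_fderiv_le (f := fun p => f (π p))
    (fun ω => (hW.2.1 ω).comp_continuous hπc hπm)
    (hf.comp_continuous ((hπc.comp continuous_fst).prodMk continuous_snd)
      fun q => ⟨hπm _, Set.mem_univ _⟩)
    (fun p => (hC1 _).differentiable one_ne_zero) (fun p => hmono _) (fun p => hB _) hk i hr hrs hs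
    hu hut ht
  refine le_trans (le_of_eq (lintegral_congr fun ω => ?_)) key
  congr 3
  refine intervalIntegral.integral_congr fun x hx => intervalIntegral.integral_congr fun y hy => ?_
  rw [Set.uIcc_of_le hrs.le] at hx
  rw [Set.uIcc_of_le hut.le] at hy
  have : π (x, y) = (x, y) := hπe _ ⟨⟨hr.le.trans hx.1, hu.le.trans hy.1⟩,
    ⟨hx.2.trans hs, hy.2.trans ht⟩⟩
  simp only [this]
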